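/- arXiv:2110.13127 — 4 statements merged into one kernel-verified Lean document; each statement's English description precedes it below -/
import Mathlib

section
/- Let k be a field of characteristic zero, let k₁ be a finite field extension of k, and let n be a positive integer. Then the kernel of the natural homomorphism kˣ/(kˣ)ⁿ → k₁ˣ/(k₁ˣ)ⁿ induced by the inclusion k ⊆ k₁ is finite. -/
/-- The natural homomorphism `kˣ/(kˣ)ⁿ → k₁ˣ/(k₁ˣ)ⁿ` induced by a field extension
`k ⊆ k₁`. -/
def powQuotientMap (k k₁ : Type*) [Field k] [Field k₁] [Algebra k k₁] (n : ℕ) :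
    kˣ ⧸ (powMonoidHom n : kˣ →* kˣ).range →*
      k₁ˣ ⧸ (powMonoidHom n : k₁ˣ →* k₁ˣ).range :=
  QuotientGroup.map _ _ (Units.map (algebraMap k k₁ : k →* k₁)) (by
    rintro x ⟨y, rfl⟩
    exact ⟨Units.map (algebraMap k k₁ : k →* k₁) y, by
      simp [powMonoidHom, Subgroup.mem_comap, ← map_pow]⟩)

/-- An element of a finite extension in characteristic zero that is fixed by every embedding into
an algebraic closure lies in the base field. -/
lemma exists_algebraMap_eq_of_forall_algHom_eq {k k₁ : Type*} [Field k] [CharZero k] [Field k₁]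
    [Algebra k k₁] [FiniteDimensional k k₁] {c : k₁}
    (h : ∀ σ : k₁ →ₐ[k] AlgebraicClosure k₁, σ c = algebraMap k₁ (AlgebraicClosure k₁) c) :
    ∃ d : k, algebraMap k k₁ d = c := by
  have : Algebra.IsAlgebraic k (AlgebraicClosure k₁) :=
    Algebra.IsAlgebraic.trans k k₁ (AlgebraicClosure k₁)
  have : IsAlgClosure k (AlgebraicClosure k₁) := ⟨inferInstance, inferInstance⟩
  have : Normal k (AlgebraicClosure k₁) := IsAlgClosure.normal k _
  have : IsGalois k (AlgebraicClosure k₁) := ⟨⟩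
  obtain ⟨d, hd⟩ := (InfiniteGalois.mem_range_algebraMap_iff_fixed
    (algebraMap k₁ (AlgebraicClosure k₁) c)).mpr fun f =>
      h (f.toAlgHom.comp (IsScalarTower.toAlgHom k k₁ (AlgebraicClosure k₁)))
  refine ⟨d, (algebraMap k₁ (AlgebraicClosure k₁)).injective ?_⟩
  rw [← IsScalarTower.algebraMap_apply, hd]

/-- A class in the kernel of `powQuotientMap` is represented by an element of `k` that becomes an
`n`-th power in `k₁`. -/
lemma exists_pow_eq_of_mem_ker_powQuotientMap {k k₁ : Type*} [Field k] [Field k₁] [Algebra k k₁]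
    {n : ℕ} {x : kˣ ⧸ (powMonoidHom n : kˣ →* kˣ).range} (hx : x ∈ (powQuotientMap k k₁ n).ker) :
    ∃ (a : kˣ) (b : k₁ˣ), (a : kˣ ⧸ (powMonoidHom n : kˣ →* kˣ).range) = x ∧
      b ^ n = Units.map (algebraMap k k₁ : k →* k₁) a := by
  obtain ⟨a, rfl⟩ := QuotientGroup.mk_surjective x
  rw [MonoidHom.mem_ker, powQuotientMap, QuotientGroup.map_mk, QuotientGroup.eq_one_iff] at hx
  obtain ⟨b, hb⟩ := hx
  exact ⟨a, b, rfl, hb⟩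

/-- If `k₁/k` is a finite extension of fields of characteristic zero and `n` is a
positive integer, then the kernel of the natural map `kˣ/(kˣ)ⁿ → k₁ˣ/(k₁ˣ)ⁿ` is
finite. -/
theorem ker_powQuotientMap_finite (k k₁ : Type*) [Field k] [CharZero k] [Field k₁]
    [Algebra k k₁] [FiniteDimensional k k₁] (n : ℕ) (hn : 0 < n) :
    Finite (powQuotientMap k k₁ n).ker := by
  have : NeZero n := ⟨hn.ne'⟩
  choose a b ha hb using fun x : (powQuotientMap k k₁ n).ker =>
    exists_pow_eq_of_mem_ker_powQuotientMap x.2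
  let K := AlgebraicClosure k₁
  let ι : k₁ˣ →* Kˣ := Units.map (algebraMap k₁ K : k₁ →* K)
  let cocycle (x : (powQuotientMap k k₁ n).ker) (σ : k₁ →ₐ[k] K) : rootsOfUnity n K :=
    ⟨Units.map (σ : k₁ →* K) (b x) / ι (b x), by
      rw [mem_rootsOfUnity, div_pow, ← map_pow, ← map_pow, hb, div_eq_one]
      ext
      simp [ι, ← IsScalarTower.algebraMap_apply]⟩
  refine Finite.of_injective cocycle fun x y hxy => Subtype.ext ?_
  obtain ⟨d, hd⟩ := exists_algebraMap_eq_of_forall_algHom_eq (k := k)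
    (c := Units.val ((b x)⁻¹ * b y)) fun σ => by
      have h := congrArg Subtype.val (congrFun hxy σ)
      change Units.map (σ : k₁ →* K) (b x) / ι (b x) =
        Units.map (σ : k₁ →* K) (b y) / ι (b y) at h
      have h' : Units.map (σ : k₁ →* K) ((b x)⁻¹ * b y) = ι ((b x)⁻¹ * b y) := by
        rw [map_mul, map_mul, map_inv, map_inv, inv_mul_eq_iff_eq_mul, ← mul_assoc,
          ← div_eq_mul_inv, h, div_mul_cancel]
      exact congrArg Units.val h'
  have hd0 : d ≠ 0 := by
    rintro rfl
    exact Units.ne_zero _ (hd.symm.trans (map_zero _))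
  rw [← ha x, ← ha y, QuotientGroup.eq]
  refine ⟨Units.mk0 d hd0, Units.map_injective (f := (algebraMap k k₁ : k →* k₁))
    (algebraMap k k₁).injective ?_⟩
  have hd' : Units.map (algebraMap k k₁ : k →* k₁) (Units.mk0 d hd0) = (b x)⁻¹ * b y :=
    Units.ext hd
  rw [powMonoidHom_apply, map_pow, hd', mul_pow, inv_pow, hb, hb, map_mul, map_inv]
end

section
/- Let P be an abelian group, let n be a positive integer, and suppose that the n-torsion subgroup {p ∈ P : n·p = 0} of P is finite. Let D ⊆ P be a finitely generated subgroup. Then the n-torsion subgroup of the quotient group P/D is finite. -/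
/-- Let `P` be an abelian group, `n` a positive integer, and suppose the `n`-torsion
subgroup of `P` is finite. Let `D ⊆ P` be a finitely generated subgroup. Then the
`n`-torsion subgroup of the quotient `P ⧸ D` is finite. -/
theorem torsion_finite_of_quotient_by_fg
    (P : Type*) [AddCommGroup P] (n : ℕ) (hn : 0 < n)
    (hP : {p : P | n • p = 0}.Finite)
    (D : AddSubgroup P) (hD : D.FG) :
    {q : P ⧸ D | n • q = 0}.Finite := by
  have : AddGroup.FG D := (AddGroup.fg_iff_addSubgroup_fg D).mpr hD
  have : Finite (D ⧸ (nsmulAddMonoidHom (α := D) n).range) :=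
    AddSubgroup.finiteIndex_iff_finite_quotient.mp
      (AddSubgroup.finiteIndex_range_nsmulAddMonoidHom_of_fg D hn.ne')
  have mem (q : {q : P ⧸ D | n • q = 0}) : n • q.1.out ∈ D := by
    rw [← QuotientAddGroup.eq_zero_iff, QuotientAddGroup.mk_nsmul, QuotientAddGroup.out_eq']
    exact q.2
  let f (q : {q : P ⧸ D | n • q = 0}) : D ⧸ (nsmulAddMonoidHom (α := D) n).range :=
    QuotientAddGroup.mk ⟨n • q.1.out, mem q⟩
  refine Set.finite_coe_iff.mp (Set.finite_univ_iff.mp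
    (Set.Finite.of_finite_fibers f (Set.toFinite _) ?_))
  rintro _ ⟨q₀, -, rfl⟩
  rw [Set.univ_inter]
  refine Set.Finite.of_finite_image (f := Subtype.val) ?_ Subtype.val_injective.injOn
  refine (hP.image fun p : P => q₀.1 + (p : P ⧸ D)).subset ?_
  rintro _ ⟨q, hq, rfl⟩
  obtain ⟨d, hd⟩ := QuotientAddGroup.eq.mp (Set.mem_singleton_iff.mp hq).symm
  have hd' : n • (d : P) = -(n • q₀.1.out) + n • q.1.out := congrArg Subtype.val hd
  refine ⟨q.1.out - q₀.1.out - d, ?_, ?_⟩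
  · simp only [Set.mem_ofPred_eq, nsmul_sub, hd']
    abel
  · have h0 : ((d : P) : P ⧸ D) = 0 := (QuotientAddGroup.eq_zero_iff _).mpr d.2
    simp only [QuotientAddGroup.mk_sub, QuotientAddGroup.out_eq', h0]
    abel
end

section
/- The Selmer curve has no nontrivial rational points: if x, y, z are rational numbers satisfying 3x³ + 4y³ + 5z³ = 0, then x = 0, y = 0 and z = 0. -/
/-- `1, θ, θ²` is an integral basis of the commutative ring `R`, and `θ³ = 6`. -/
structure IsCubeRootSixBasis {R : Type*} [CommRing R] (θ : R) : Prop where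
  pow_three : θ ^ 3 = 6
  span (x : R) : ∃ a b c : ℤ, x = a + b * θ + c * θ ^ 2
  indep {a b c : ℤ} (h : a + b * θ + c * θ ^ 2 = 0) : a = 0 ∧ b = 0 ∧ c = 0

namespace IsCubeRootSixBasis

/-- The norm of `a + bθ + cθ²`. -/
def normForm (a b c : ℤ) : ℤ := a ^ 3 + 6 * b ^ 3 + 36 * c ^ 3 - 18 * a * b * c

variable {R : Type*} [CommRing R] {θ : R}

theorem coords_ext (h : IsCubeRootSixBasis θ) {a b c a' b' c' : ℤ}
    (he : (a + b * θ + c * θ ^ 2 : R) = a' + b' * θ + c' * θ ^ 2) : a = a' ∧ b = b' ∧ c = c' := by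
  have := h.indep (a := a - a') (b := b - b') (c := c - c') (by push_cast; linear_combination he)
  omega

theorem mul_coords (h : IsCubeRootSixBasis θ) (a b c a' b' c' : ℤ) :
    (a + b * θ + c * θ ^ 2 : R) * (a' + b' * θ + c' * θ ^ 2) =
      ((a * a' + 6 * (b * c' + c * b') : ℤ) : R) + ((a * b' + b * a' + 6 * c * c' : ℤ) : R) * θ +
      ((a * c' + b * b' + c * a' : ℤ) : R) * θ ^ 2 := by
  push_cast
  linear_combination ((b * c' + c * b' : R) + c * c' * θ) * h.pow_three

theorem normForm_of_isUnit (h : IsCubeRootSixBasis θ) {a b c : ℤ}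
    (hu : IsUnit (a + b * θ + c * θ ^ 2 : R)) : normForm a b c = 1 ∨ normForm a b c = -1 := by
  obtain ⟨v, hv⟩ := hu.exists_right_inv
  obtain ⟨a', b', c', rfl⟩ := h.span v
  rw [h.mul_coords] at hv
  obtain ⟨h1, h2, h3⟩ := h.coords_ext (a' := 1) (b' := 0) (c' := 0) (hv.trans (by simp))
  refine Int.isUnit_iff.mp (IsUnit.of_mul_eq_one (normForm a' b' c') ?_)
  have : normForm a b c * normForm a' b' c' = normForm (a * a' + 6 * (b * c' + c * b'))
      (a * b' + b * a' + 6 * c * c') (a * c' + b * b' + c * a') := by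
    simp only [normForm]; ring
  rw [this, h1, h2, h3]
  simp [normForm]

theorem map_bounds (h : IsCubeRootSixBasis θ) (φ : R →+* ℝ) :
    φ θ ^ 3 = 6 ∧ 1.8171 < φ θ ∧ φ θ < 1.8172 := by
  have ht : φ θ ^ 3 = 6 := by rw [← map_pow, h.pow_three, map_ofNat]
  refine ⟨ht, lt_of_pow_lt_pow_left₀ 3 ?_ ?_, lt_of_pow_lt_pow_left₀ 3 ?_ ?_⟩ <;>
    norm_num [ht]
  by_contra! hh
  nlinarith [sq_nonneg (φ θ)]

/-- A unit whose image in `ℝ` has absolute value in `[1, 18.1]` is `±1`. -/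
theorem eq_one_or_eq_neg_one_of_isUnit (h : IsCubeRootSixBasis θ) (φ : R →+* ℝ) {u : R}
    (hu : IsUnit u) (h1 : 1 ≤ |φ u|) (h2 : |φ u| ≤ 18.1) : u = 1 ∨ u = -1 := by
  obtain ⟨a, b, c, rfl⟩ := h.span u
  have hN := h.normForm_of_isUnit hu
  obtain ⟨ht, ht1, ht2⟩ := h.map_bounds φ
  simp only [map_add, map_mul, map_intCast, map_pow] at h1 h2
  set t := φ θ
  have hNt : (normForm a b c : ℝ) = (a + b * t + c * t ^ 2) *
      (((a - b * t) ^ 2 + (a - c * t ^ 2) ^ 2 + (b * t - c * t ^ 2) ^ 2) / 2) := by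
    simp only [normForm]
    push_cast
    linear_combination (-(b : ℝ) ^ 3 - c ^ 3 * (t ^ 3 + 6) + 3 * a * b * c) * ht
  have habs : |(normForm a b c : ℝ)| = 1 := by
    rcases hN with h | h <;> simp [h]
  rw [hNt, abs_mul, abs_of_nonneg (a := _ / 2) (by positivity)] at habs
  have hq : (a - b * t) ^ 2 + (a - c * t ^ 2) ^ 2 + (b * t - c * t ^ 2) ^ 2 ≤ 2 := by
    by_contra! hh
    nlinarith
  have hab : |a - b * t| ≤ 1.5 := abs_le_of_sq_le_sq
    (by nlinarith [sq_nonneg (a - c * t ^ 2), sq_nonneg (b * t - c * t ^ 2)]) (by norm_num)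
  have hac : |a - c * t ^ 2| ≤ 1.5 := abs_le_of_sq_le_sq
    (by nlinarith [sq_nonneg (a - b * t), sq_nonneg (b * t - c * t ^ 2)]) (by norm_num)
  have hbc : |b * t - c * t ^ 2| ≤ 1.5 := abs_le_of_sq_le_sq
    (by nlinarith [sq_nonneg (a - b * t), sq_nonneg (a - c * t ^ 2)]) (by norm_num)
  rw [abs_le] at hab hac hbc h2
  have t2 : 3.24 < t ^ 2 := by nlinarith
  have ha1 : (a : ℝ) < 8 := by linarith
  have ha2 : (-8 : ℝ) < a := by linarith
  have hb1 : (b : ℝ) < 5 := by nlinarith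
  have hb2 : (-5 : ℝ) < b := by nlinarith
  have hc1 : (c : ℝ) < 3 := by nlinarith
  have hc2 : (-3 : ℝ) < c := by nlinarith
  norm_cast at ha1 ha2 hb1 hb2 hc1 hc2
  have key : ∀ a ∈ Finset.Ioo (-8 : ℤ) 8, ∀ b ∈ Finset.Ioo (-5 : ℤ) 5,
      ∀ c ∈ Finset.Ioo (-3 : ℤ) 3, (normForm a b c = 1 ∨ normForm a b c = -1) →
      (a = 1 ∨ a = -1) ∧ b = 0 ∧ c = 0 := by decide +kernel
  obtain ⟨rfl | rfl, rfl, rfl⟩ := key a (by simp; omega) b (by simp; omega) c (by simp; omega) hN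
  · simp
  · simp

/-- The unit `109 + 60θ + 33θ²`, with inverse `1 - 6θ + 3θ²`. -/
def fundamentalUnit (h : IsCubeRootSixBasis θ) : Rˣ where
  val := 109 + 60 * θ + 33 * θ ^ 2
  inv := 1 - 6 * θ + 3 * θ ^ 2
  val_inv := by linear_combination (-18 + 99 * θ) * h.pow_three
  inv_val := by linear_combination (-18 + 99 * θ) * h.pow_three

theorem exists_eq_zpow (h : IsCubeRootSixBasis θ) (φ : R →+* ℝ) (u : Rˣ) :
    ∃ n : ℤ, u = h.fundamentalUnit ^ n ∨ u = -h.fundamentalUnit ^ n := by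
  obtain ⟨-, ht1, ht2⟩ := h.map_bounds φ
  set η := h.fundamentalUnit
  have hη : |φ η| = 109 + 60 * φ θ + 33 * φ θ ^ 2 := by
    rw [show (η : R) = 109 + 60 * θ + 33 * θ ^ 2 from rfl, map_add, map_add, map_mul, map_mul,
      map_pow, map_ofNat φ 109, map_ofNat φ 60, map_ofNat φ 33]
    exact abs_of_pos (by positivity)
  have hη1 : 1 < |φ η| := by nlinarith
  have hη2 : |φ η| ≤ 18.1 * 18.1 := by nlinarith
  have hpos (v : Rˣ) : 0 < |φ v| := abs_pos.mpr (v.isUnit.map φ).ne_zero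
  have hunit (v : Rˣ) (h1 : 1 ≤ |φ v|) (h2 : |φ v| ≤ 18.1) : v = 1 ∨ v = -1 := by
    exact (h.eq_one_or_eq_neg_one_of_isUnit φ v.isUnit h1 h2).imp (Units.ext ·) (Units.ext ·)
  have hzpow (k : ℤ) : |φ ((η ^ k : Rˣ) : R)| = |φ η| ^ k := by
    rw [← abs_zpow]
    exact congr_arg abs ((congr_arg Units.val (map_zpow (Units.map (φ : R →* ℝ)) η k)).trans
      (Units.val_zpow_eq_zpow_val _ _))
  obtain ⟨n, hn1, hn2⟩ := exists_mem_Ico_zpow (hpos u) hη1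
  rw [← hzpow] at hn1 hn2
  by_cases hsmall : |φ u| ≤ 18.1 * |φ ((η ^ n : Rˣ) : R)|
  · obtain ⟨v, rfl⟩ : ∃ v, u = v * η ^ n := ⟨u * (η ^ n)⁻¹, by simp⟩
    simp only [Units.val_mul, map_mul, abs_mul] at hn1 hsmall
    have := hpos (η ^ n)
    refine ⟨n, ?_⟩
    rcases hunit v (by nlinarith) (by nlinarith) with rfl | rfl <;> simp
  · obtain ⟨v, hv⟩ : ∃ v, η ^ (n + 1) = v * u := ⟨η ^ (n + 1) * u⁻¹, by simp⟩
    have hw : |φ ((η ^ n : Rˣ) : R)| * |φ η| = |φ v| * |φ u| := by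
      rw [← abs_mul, ← abs_mul, ← map_mul, ← map_mul, ← Units.val_mul, ← Units.val_mul, ← hv,
        zpow_add_one]
    rw [hv] at hn2
    simp only [Units.val_mul, map_mul, abs_mul] at hn2
    have := hpos u
    have := hpos (η ^ n)
    refine ⟨n + 1, ?_⟩
    have h1 : 1 ≤ |φ v| := by nlinarith
    have h2 : |φ v| ≤ 18.1 := by
      by_contra! hh
      nlinarith
    rcases hunit v h1 h2 with rfl | rfl <;> simp [hv]

theorem exists_dvd_unit_sub (h : IsCubeRootSixBasis θ) (φ : R →+* ℝ) (u : Rˣ) :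
    ∃ n : ℤ, (3 : R) ∣ u - n := by
  let π := Ideal.Quotient.mk (Ideal.span {(3 : R)})
  have hη : Units.map (π : R →* R ⧸ Ideal.span {(3 : R)}) h.fundamentalUnit = 1 := by
    ext
    rw [Units.coe_map, Units.val_one, ← map_one π]
    refine Ideal.Quotient.eq.mpr (Ideal.mem_span_singleton.mpr ⟨36 + 20 * θ + 11 * θ ^ 2, ?_⟩)
    simp only [fundamentalUnit]
    ring
  have hπ (v : Rˣ) :
      (Units.map (π : R →* R ⧸ Ideal.span {(3 : R)}) v : R ⧸ Ideal.span {(3 : R)}) = π v := rfl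
  obtain ⟨n, rfl | rfl⟩ := h.exists_eq_zpow φ u
  · refine ⟨1, Ideal.mem_span_singleton.mp (Ideal.Quotient.eq.mp ?_)⟩
    rw [← hπ, map_zpow, hη]
    simp
  · refine ⟨-1, Ideal.mem_span_singleton.mp (Ideal.Quotient.eq.mp ?_)⟩
    rw [Units.val_neg, map_neg, ← hπ, map_zpow, hη]
    simp

theorem exists_dvd_cube_sub (h : IsCubeRootSixBasis θ) (x : R) : ∃ n : ℤ, (3 : R) ∣ x ^ 3 - n := by
  obtain ⟨a, b, c, rfl⟩ := h.span x
  refine ⟨a ^ 3, 2 * b ^ 3 + 12 * c ^ 3 + 12 * a * b * c +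
    (a ^ 2 * b + 6 * a * c ^ 2 + 6 * b ^ 2 * c) * θ +
    (a ^ 2 * c + a * b ^ 2 + 6 * b * c ^ 2) * θ ^ 2, ?_⟩
  push_cast
  linear_combination (b ^ 3 + c ^ 3 * (θ ^ 3 + 6) + 6 * a * b * c +
    (3 * a * c ^ 2 + 3 * b ^ 2 * c) * θ +
    3 * b * c ^ 2 * θ ^ 2) * h.pow_three

theorem false_of_eq_cube_mul_unit (h : IsCubeRootSixBasis θ) (φ : R →+* ℝ) {a b : ℤ}
    (hab : IsCoprime a b) {d : R} {u : Rˣ}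
    (he : (a + b * θ : R) = (2 - θ) * (1 - θ) * (d ^ 3 * u)) : False := by
  obtain ⟨m, v, hv⟩ := h.exists_dvd_unit_sub φ u
  obtain ⟨n, w, hw⟩ := h.exists_dvd_cube_sub d
  obtain ⟨e, f, g, hefg⟩ := h.span ((2 - θ) * (1 - θ) * (n * v + m * w + 3 * v * w))
  obtain ⟨h1, h2, h3⟩ := h.coords_ext (a := a) (b := b) (c := 0) (a' := 2 * (m * n) + 3 * e)
    (b' := -3 * (m * n) + 3 * f) (c' := m * n + 3 * g) (by
      push_cast
      linear_combination he + 3 * hefg + (2 - θ) * (1 - θ) * (d ^ 3 * hv + (m + 3 * v) * hw))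
  obtain ⟨s, t, hst⟩ := hab
  have : (3 : ℤ) ∣ 1 := by
    rw [← hst]
    exact dvd_add (dvd_mul_of_dvd_right (by omega) _) (dvd_mul_of_dvd_right (by omega) _)
  omega

theorem pow_three_add_six_mul_ne [IsDomain R] [IsPrincipalIdealRing R] (h : IsCubeRootSixBasis θ)
    (φ : R →+* ℝ) {a b c : ℤ} (hab : IsCoprime a b) : a ^ 3 + 6 * b ^ 3 ≠ 10 * c ^ 3 := by
  intro he
  obtain ⟨m, rfl⟩ : (2 : ℤ) ∣ a := Int.prime_two.dvd_of_dvd_pow (n := 3) (by omega)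
  have hb : ¬ (2 : ℤ) ∣ b := fun hb => by
    exact Int.prime_two.not_isUnit (hab.isUnit_of_dvd' (dvd_mul_right 2 m) hb)
  have hc2 : ¬ (2 : ℤ) ∣ c := by
    rintro ⟨c, rfl⟩
    exact hb (Int.prime_two.dvd_of_dvd_pow (n := 3) (by ring_nf at he; omega))
  have hc3 : ¬ (3 : ℤ) ∣ c := by
    rintro ⟨c, rfl⟩
    obtain ⟨m, rfl⟩ : (3 : ℤ) ∣ m :=
      Int.prime_three.dvd_of_dvd_pow (n := 3) (by ring_nf at he; omega)
    have hb3 : (3 : ℤ) ∣ b := Int.prime_three.dvd_of_dvd_pow (n := 3) (by ring_nf at he; omega)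
    have := hab.isUnit_of_dvd' (dvd_mul_of_dvd_right (dvd_mul_right 3 m) 2) hb3
    exact Int.prime_three.not_isUnit this
  obtain ⟨k, hk⟩ : (5 : ℤ) ∣ 2 * m + b := by
    have h5 : ∀ x y : ZMod 5, x ^ 3 + 6 * y ^ 3 = 10 * 0 → x + y = 0 := by decide
    have := congr_arg (Int.cast : ℤ → ZMod 5) he
    push_cast at this
    rw [show (10 : ZMod 5) = 0 from rfl, zero_mul] at this
    refine (ZMod.intCast_zmod_eq_zero_iff_dvd _ 5).mp ?_
    push_cast
    exact h5 _ _ (by simpa using this)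
  obtain rfl : b = 5 * k - 2 * m := by omega
  have hc : IsCoprime (18 : ℤ) (c ^ 3) := by
    have h2 := (Int.prime_two.coprime_iff_not_dvd.mpr hc2)
    have h3 := (Int.prime_three.coprime_iff_not_dvd.mpr hc3)
    simpa using (h2.mul_left (h3.mul_left h3)).pow_right (n := 3)
  obtain ⟨s, t, hst⟩ := hc
  obtain ⟨p, q, hpq⟩ := hab.pow (m := 2) (n := 2)
  obtain ⟨x, hx⟩ : ∃ x, x = 4 * m - 21 * k := ⟨_, rfl⟩
  obtain ⟨y, hy⟩ : ∃ y, y = 2 * m - 11 * k := ⟨_, rfl⟩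
  obtain ⟨z, hz⟩ : ∃ z, z = m - 6 * k := ⟨_, rfl⟩
  have hN : normForm x y z = (-c) ^ 3 := by
    subst x y z
    simp only [normForm]
    linarith
  have hmul := h.mul_coords x y z (x ^ 2 - 6 * y * z) (6 * z ^ 2 - x * y) (y ^ 2 - x * z)
  set γ : R := x + y * θ + z * θ ^ 2 with hγ
  set δ : R := ((x ^ 2 - 6 * y * z : ℤ) : R) + ((6 * z ^ 2 - x * y : ℤ) : R) * θ +
    ((y ^ 2 - x * z : ℤ) : R) * θ ^ 2 with hδ
  have hγδ : γ * δ = (-c : R) ^ 3 := by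
    rw [hmul, ← Int.cast_neg, ← Int.cast_pow, ← hN]
    simp only [normForm]
    push_cast
    ring
  obtain ⟨b, hb'⟩ : ∃ b, b = 5 * k - 2 * m := ⟨_, rfl⟩
  have hα : ((2 * m : ℤ) + b * θ : R) = (2 - θ) * (1 - θ) * γ := by
    rw [hγ, hb', hx, hy, hz]
    push_cast
    linear_combination (-(θ - 3) * (m - 6 * k) - (2 * m - 11 * k)) * h.pow_three
  have hβ : ((2 * m : ℤ) ^ 2 - (2 * m : ℤ) * b * θ + b ^ 2 * θ ^ 2 : R) =
      (4 + 2 * θ + θ ^ 2) * (1 + θ + θ ^ 2) * δ := by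
    obtain ⟨d₀, h₀⟩ : ∃ d, d = x ^ 2 - 6 * y * z := ⟨_, rfl⟩
    obtain ⟨d₁, h₁⟩ : ∃ d, d = 6 * z ^ 2 - x * y := ⟨_, rfl⟩
    obtain ⟨d₂, h₂⟩ : ∃ d, d = y ^ 2 - x * z := ⟨_, rfl⟩
    have e₀ : 4 * d₀ + 6 * (3 * d₀ + 7 * d₁ + 12 * d₂) = (2 * m) ^ 2 := by
      subst h₀ h₁ h₂ x y z
      ring
    have e₁ : 6 * d₀ + 4 * d₁ + 6 * (d₀ + 3 * d₁ + 7 * d₂) = -(2 * m * b) := by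
      subst h₀ h₁ h₂ x y z b
      ring
    have e₂ : 7 * d₀ + 6 * d₁ + 4 * d₂ + 6 * (d₁ + 3 * d₂) = b ^ 2 := by
      subst h₀ h₁ h₂ x y z b
      ring
    replace e₀ := congr_arg (Int.cast : ℤ → R) e₀
    replace e₁ := congr_arg (Int.cast : ℤ → R) e₁
    replace e₂ := congr_arg (Int.cast : ℤ → R) e₂
    rw [hδ, ← h₀, ← h₁, ← h₂]
    push_cast at e₀ e₁ e₂ ⊢
    linear_combination -e₀ - θ * e₁ - θ ^ 2 * e₂ - (3 * d₀ + 7 * d₁ + 6 * d₂ +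
      (d₀ + 3 * d₁ + 7 * d₂) * θ + (d₁ + 3 * d₂) * θ ^ 2 + d₂ * (θ ^ 3 + 6)) * h.pow_three
  have hcop : IsCoprime γ δ := by
    refine ⟨(-6 * s * p * (b * θ - 2 * (2 * m)) - s * q * θ * (2 * m - 2 * b * θ)) *
      ((2 - θ) * (1 - θ)) - t * δ,
      (6 * s * p + s * q * θ) * ((4 + 2 * θ + θ ^ 2) * (1 + θ + θ ^ 2)), ?_⟩
    rw [← hb'] at hpq
    have hst' := congr_arg (Int.cast : ℤ → R) hst
    have hpq' := congr_arg (Int.cast : ℤ → R) hpq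
    push_cast at hα hβ hst' hpq'
    linear_combination (6 * s * p * (b * θ - 2 * (2 * m)) + s * q * θ * (2 * m - 2 * b * θ)) * hα -
      (6 * s * p + s * q * θ) * hβ - t * hγδ + 3 * s * q * b ^ 2 * h.pow_three + 18 * s * hpq' + hst'
  obtain ⟨d, u, hd⟩ := exists_associated_pow_of_mul_eq_pow' hcop hγδ
  exact h.false_of_eq_cube_mul_unit φ (hb' ▸ hab) (by rw [hα, ← hd])

theorem dvd_of_intCast_mem {P : Ideal R} (hP : P ≠ ⊤) {p : ℤ} (hp : Prime p) (hpP : (p : R) ∈ P)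
    {n : ℤ} (hn : (n : R) ∈ P) : p ∣ n := by
  by_contra hpn
  obtain ⟨s, t, hst⟩ := hp.coprime_iff_not_dvd.mpr hpn
  refine hP ((Ideal.eq_top_iff_one P).mpr ?_)
  rw [← Int.cast_one, ← hst]
  push_cast
  exact add_mem (P.mul_mem_left _ hpP) (P.mul_mem_left _ hn)

/-- If `g` divides both a prime number `p` and `θ - r`, then every prime ideal above `p` containing
`g` is generated by `g`. -/
theorem eq_span_of_dvd_sub (h : IsCubeRootSixBasis θ) {P : Ideal R} (hP : P ≠ ⊤) {p : ℤ}
    (hp : Prime p) (hpP : (p : R) ∈ P) {g : R} (hg : g ∈ P) (r : ℤ) (hgp : g ∣ p)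
    (hgr : g ∣ θ - r) : P = Ideal.span {g} := by
  refine le_antisymm (fun x hx => Ideal.mem_span_singleton.mpr ?_)
    ((Ideal.span_singleton_le_iff_mem P).mpr hg)
  obtain ⟨a, b, c, rfl⟩ := h.span x
  have hsub : g ∣ (a + b * θ + c * θ ^ 2 : R) - (a + b * r + c * r ^ 2 : ℤ) := by
    refine hgr.trans ⟨b + c * (θ + r), ?_⟩
    push_cast
    ring
  refine (dvd_iff_dvd_of_dvd_sub hsub).mpr (hgp.trans (Int.cast_dvd_cast _ _ ?_))
  refine dvd_of_intCast_mem hP hp hpP ?_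
  simpa using sub_mem hx (Ideal.mem_of_dvd P hsub hg)

theorem isPrincipal_of_mem (h : IsCubeRootSixBasis θ) {P : Ideal R} [hP : P.IsPrime] {p : ℤ}
    (hp : p = 2 ∨ p = 3 ∨ p = 5 ∨ p = 7) (hpP : (p : R) ∈ P) : P.IsPrincipal := by
  have hθ := h.pow_three
  rcases hp with rfl | rfl | rfl | rfl
  · have hθP : θ ∈ P := hP.mem_of_pow_mem 3 (by
      convert! P.mul_mem_left 3 hpP using 1
      push_cast
      linear_combination hθ)
    refine ⟨θ - 2, h.eq_span_of_dvd_sub hP.ne_top Int.prime_two hpP ?_ 2 ?_ ?_⟩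
    · exact sub_mem hθP (by simpa using hpP)
    · exact ⟨-(4 + 2 * θ + θ ^ 2), by push_cast; linear_combination hθ⟩
    · simp
  · have hθP : θ ∈ P := hP.mem_of_pow_mem 3 (by
      convert! P.mul_mem_left 2 hpP using 1
      push_cast
      linear_combination hθ)
    refine ⟨3 + 2 * θ + θ ^ 2, h.eq_span_of_dvd_sub hP.ne_top Int.prime_three hpP ?_ 0 ?_ ?_⟩
    · convert! P.add_mem (P.mul_mem_left (2 + θ) hθP) hpP using 1
      push_cast
      ring
    · exact ⟨θ ^ 2 - 3, by push_cast; linear_combination (-2 - θ) * hθ⟩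
    · exact ⟨2 - θ, by push_cast; linear_combination hθ⟩
  · have hmul : (θ - 1) * (1 + θ + θ ^ 2) ∈ P := by
      convert! hpP using 1
      push_cast
      linear_combination hθ
    rcases hP.mem_or_mem hmul with hg | hg
    · refine ⟨θ - 1, h.eq_span_of_dvd_sub hP.ne_top (by norm_num) hpP hg 1 ?_ ?_⟩
      · exact ⟨1 + θ + θ ^ 2, by push_cast; linear_combination -hθ⟩
      · simp
    · refine ⟨1 + θ + θ ^ 2, le_antisymm (fun x hx => Ideal.mem_span_singleton.mpr ?_)
        ((Ideal.span_singleton_le_iff_mem P).mpr hg)⟩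
      obtain ⟨a, b, c, rfl⟩ := h.span x
      obtain ⟨n, hn⟩ : ∃ n, n = a - c := ⟨_, rfl⟩
      obtain ⟨m, hm⟩ : ∃ m, m = b - c := ⟨_, rfl⟩
      have hnm : ((n ^ 2 - n * m + 6 * m ^ 2 : ℤ) : R) ∈ P := by
        convert! sub_mem (P.mul_mem_left (n + m * θ ^ 2) hx)
          (P.mul_mem_left (c * (n + m * θ ^ 2) + n * m) hg) using 1
        rw [hn, hm]
        push_cast
        linear_combination (-(b - c) ^ 2 : R) * hθ
      have h5 : ∀ x y : ZMod 5, x ^ 2 - x * y + 6 * y ^ 2 = 0 → x = 0 ∧ y = 0 := by decide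
      have hdvd := (ZMod.intCast_zmod_eq_zero_iff_dvd _ 5).mpr
        (dvd_of_intCast_mem hP.ne_top (by norm_num) hpP hnm)
      push_cast at hdvd
      obtain ⟨hn5, hm5⟩ := h5 _ _ hdvd
      obtain ⟨n, rfl⟩ := (ZMod.intCast_zmod_eq_zero_iff_dvd _ 5).mp hn5
      obtain ⟨m, rfl⟩ := (ZMod.intCast_zmod_eq_zero_iff_dvd _ 5).mp hm5
      obtain rfl : a = 5 * n + c := by push_cast at hn; omega
      obtain rfl : b = 5 * m + c := by push_cast at hm; omega
      refine ⟨c + (θ - 1) * (n + m * θ), ?_⟩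
      push_cast
      linear_combination (-(n + m * θ) : R) * hθ
  · have hmul : (θ + 1) * ((θ - 3) * (θ - 5)) ∈ P := by
      convert! P.mul_mem_left (1 + (θ + 1) * (2 - θ)) hpP using 1
      push_cast
      linear_combination hθ
    have h7 : (7 : R) ∈ P := by simpa using hpP
    rcases hP.mem_or_mem hmul with hg | hg
    · refine ⟨θ + 1, h.eq_span_of_dvd_sub hP.ne_top (by norm_num) hpP hg (-1) ?_ ?_⟩
      · exact ⟨θ ^ 2 - θ + 1, by push_cast; linear_combination -hθ⟩
      · simp
    rcases hP.mem_or_mem hg with hg | hg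
    · refine ⟨5 - θ - θ ^ 2, h.eq_span_of_dvd_sub hP.ne_top (by norm_num) hpP ?_ 3 ?_ ?_⟩
      · convert! sub_mem (P.mul_mem_left (-4 - θ) hg) h7 using 1
        ring
      · exact ⟨-(19 + 11 * θ + 6 * θ ^ 2), by
          push_cast; linear_combination (-17 - 6 * θ) * hθ⟩
      · exact ⟨3 + 2 * θ + θ ^ 2, by push_cast; linear_combination (3 + θ) * hθ⟩
    · refine ⟨7 + 4 * θ + 2 * θ ^ 2, h.eq_span_of_dvd_sub hP.ne_top (by norm_num) hpP ?_ 5 ?_ ?_⟩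
      · convert! add_mem (P.mul_mem_left (2 * θ) hg) (P.mul_mem_left (1 + 2 * θ) h7) using 1
        ring
      · exact ⟨1 - 4 * θ + 2 * θ ^ 2, by push_cast; linear_combination (-4 * θ) * hθ⟩
      · refine ⟨(2 - θ) - (1 - 4 * θ + 2 * θ ^ 2), ?_⟩
        push_cast
        linear_combination (2 + 4 * θ) * hθ

end IsCubeRootSixBasis

section CubicField

open NumberField Polynomial

variable {K : Type*} [Field K] [NumberField K] {B : PowerBasis ℚ K}

theorem isEisensteinAt_X_pow_three_sub_six {p : ℤ} (hp : Prime p) (h6 : p ∣ 6) (h36 : ¬ p ^ 2 ∣ 6) :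
    (X ^ 3 - 6 : ℤ[X]).IsEisensteinAt (Submodule.span ℤ {p}) := by
  have hdeg : (X ^ 3 - 6 : ℤ[X]).natDegree = 3 := by compute_degree!
  have hmonic : (X ^ 3 - 6 : ℤ[X]).Monic := by monicity!
  refine hmonic.isEisensteinAt_of_mem_of_notMem ?_ (fun {n} hn => ?_) ?_
  · exact (Ideal.span_singleton_prime hp.ne_zero).mpr hp |>.ne_top
  · rw [hdeg] at hn
    refine Ideal.mem_span_singleton.mpr ?_
    interval_cases n <;> simp [h6]
  · rw [Ideal.submodule_span_eq, Ideal.span_singleton_pow, Ideal.mem_span_singleton]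
    simpa using h36

theorem irreducible_X_pow_three_sub_six : Irreducible (X ^ 3 - 6 : ℚ[X]) := by
  have hmonic : (X ^ 3 - 6 : ℤ[X]).Monic := by monicity!
  have h := (isEisensteinAt_X_pow_three_sub_six Int.prime_two (by norm_num) (by norm_num)).irreducible
    ((Ideal.span_singleton_prime two_ne_zero).mpr Int.prime_two) hmonic.isPrimitive
    (by rw [show (X ^ 3 - 6 : ℤ[X]).natDegree = 3 by compute_degree!]; norm_num)
  simpa using (hmonic.irreducible_iff_irreducible_map_fraction_map (K := ℚ)).mp h

theorem gen_pow_three (hB : minpoly ℚ B.gen = X ^ 3 - 6) : B.gen ^ 3 = 6 := by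
  have := minpoly.aeval ℚ B.gen
  rwa [hB, map_sub, map_pow, aeval_X, map_ofNat, sub_eq_zero] at this

theorem isIntegral_gen (hB : minpoly ℚ B.gen = X ^ 3 - 6) : IsIntegral ℤ B.gen :=
  ⟨X ^ 3 - 6, by monicity!, by simp [gen_pow_three hB]⟩

theorem minpoly_int (hB : minpoly ℚ B.gen = X ^ 3 - 6) : minpoly ℤ B.gen = X ^ 3 - 6 := by
  refine map_injective (algebraMap ℤ ℚ) (algebraMap ℤ ℚ).injective_int ?_
  rw [← minpoly.isIntegrallyClosed_eq_field_fractions' ℚ (isIntegral_gen hB), hB]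
  simp

theorem dim_eq_three (hB : minpoly ℚ B.gen = X ^ 3 - 6) : B.dim = 3 := by
  rw [← B.natDegree_minpoly, hB]
  compute_degree!

theorem discr_basis (hB : minpoly ℚ B.gen = X ^ 3 - 6) :
    Algebra.discr ℚ B.basis = -972 := by
  have hd := dim_eq_three hB
  have hr : Module.finrank ℚ K = 3 := by rw [B.finrank, hd]
  have hN : Algebra.norm ℚ B.gen = 6 := by
    rw [Algebra.PowerBasis.norm_gen_eq_coeff_zero_minpoly, hB, hd]
    simp
    norm_num
  rw [Algebra.discr_powerBasis_eq_norm, hB, hr]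
  have : aeval B.gen (derivative (X ^ 3 - 6 : ℚ[X])) = algebraMap ℚ K 3 * B.gen ^ 2 := by
    simp
    norm_num
  rw [this, map_mul, map_pow, hN, Algebra.norm_algebraMap, hr]
  norm_num

theorem mem_adjoin_gen (hB : minpoly ℚ B.gen = X ^ 3 - 6) {x : K}
    (hx : IsIntegral ℤ x) : x ∈ Algebra.adjoin ℤ ({B.gen} : Set K) := by
  have h := Algebra.discr_mul_isIntegral_mem_adjoin ℚ (R := ℤ) (B := B) (isIntegral_gen hB) hx
  have hi := isIntegral_gen hB
  rw [discr_basis hB] at h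
  refine mem_adjoin_of_smul_prime_pow_smul_of_minpoly_isEisensteinAt (K := ℚ) (p := (3 : ℤ))
    (n := 5) Int.prime_three hi hx ?_
    (minpoly_int hB ▸ isEisensteinAt_X_pow_three_sub_six Int.prime_three (by norm_num) (by norm_num))
  refine mem_adjoin_of_smul_prime_pow_smul_of_minpoly_isEisensteinAt (K := ℚ) (p := (2 : ℤ))
    (n := 2) Int.prime_two hi (hx.smul _) ?_
    (minpoly_int hB ▸ isEisensteinAt_X_pow_three_sub_six Int.prime_two (by norm_num) (by norm_num))
  convert neg_mem h using 1
  simp [Algebra.smul_def]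
  ring

theorem exists_coords (hB : minpoly ℚ B.gen = X ^ 3 - 6) {x : K}
    (hx : IsIntegral ℤ x) : ∃ a b c : ℤ, x = a + b * B.gen + c * B.gen ^ 2 := by
  have h3 := gen_pow_three hB
  have hadj := mem_adjoin_gen hB hx
  clear hx
  induction hadj using Algebra.adjoin_induction with
  | mem y hy => exact ⟨0, 1, 0, by simp_all⟩
  | algebraMap r => exact ⟨r, 0, 0, by simp⟩
  | add y z _ _ hy hz =>
    obtain ⟨a, b, c, rfl⟩ := hy
    obtain ⟨a', b', c', rfl⟩ := hz
    refine ⟨a + a', b + b', c + c', ?_⟩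
    push_cast
    ring
  | mul y z _ _ hy hz =>
    obtain ⟨a, b, c, rfl⟩ := hy
    obtain ⟨a', b', c', rfl⟩ := hz
    refine ⟨a * a' + 6 * (b * c' + c * b'), a * b' + b * a' + 6 * c * c',
      a * c' + b * b' + c * a', ?_⟩
    push_cast
    linear_combination (b * c' + c * b' + c * c' * B.gen) * h3

theorem discr_eq (hB : minpoly ℚ B.gen = X ^ 3 - 6) :
    discr K = -972 := by
  have hi := isIntegral_gen hB
  rw [← Int.cast_inj (α := ℚ), coe_discr]
  push_cast
  rw [← discr_basis hB]
  refine Algebra.discr_eq_discr_of_toMatrix_coeff_isIntegral K (fun i j => ?_) (fun i j => ?_)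
  · rw [Module.Basis.toMatrix_apply, B.basis_eq_pow]
    obtain ⟨x, hx⟩ := (IsIntegralClosure.isIntegral_iff (A := 𝓞 K)).mp (hi.pow (j : ℕ))
    rw [← hx, integralBasis_repr_apply]
    exact isIntegral_algebraMap
  · rw [Module.Basis.toMatrix_apply, integralBasis_apply]
    obtain ⟨a, b, c, habc⟩ := exists_coords hB
      (RingOfIntegers.isIntegral_coe (RingOfIntegers.basis K j))
    have (n : ℤ) (k : ℕ) : IsIntegral ℤ (B.basis.repr (n * B.gen ^ k) i) := by
      rw [← zsmul_eq_mul, map_zsmul]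
      exact (PowerBasis.repr_gen_pow_isIntegral hi
        (minpoly.isIntegrallyClosed_eq_field_fractions' ℚ hi) k i).smul n
    rw [habc]
    simpa using ((this a 0).add (this b 1)).add (this c 2)

theorem exists_isCubeRootSixBasis (hB : minpoly ℚ B.gen = X ^ 3 - 6) :
    ∃ θ : 𝓞 K, IsCubeRootSixBasis θ := by
  obtain ⟨θ, hθ⟩ := (IsIntegralClosure.isIntegral_iff (A := 𝓞 K)).mp (isIntegral_gen hB)
  have hinj := FaithfulSMul.algebraMap_injective (𝓞 K) K
  refine ⟨θ, hinj ?_, fun x => ?_, fun {a b c} h => ?_⟩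
  · rw [map_pow, hθ, gen_pow_three hB, map_ofNat]
  · obtain ⟨a, b, c, h⟩ := exists_coords hB (RingOfIntegers.isIntegral_coe x)
    exact ⟨a, b, c, hinj (by simpa [hθ] using h)⟩
  · have h0 : aeval B.gen (C (a : ℚ) + C (b : ℚ) * X + C (c : ℚ) * X ^ 2) = 0 := by
      simpa [hθ] using congr_arg (algebraMap (𝓞 K) K) h
    have hP := eq_zero_of_dvd_of_degree_lt (minpoly.dvd ℚ _ h0) (by
      rw [hB, show (X ^ 3 - 6 : ℚ[X]).degree = 3 by compute_degree!]
      exact lt_of_le_of_lt (b := 2) (by compute_degree) (by norm_num))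
    have h' (n : ℕ) := congr_arg (coeff · n) hP
    have h₀ := h' 0
    have h₁ := h' 1
    have h₂ := h' 2
    simp only [coeff_add, coeff_C_mul, coeff_C, coeff_X, coeff_X_pow, coeff_zero] at h₀ h₁ h₂
    norm_num at h₀ h₁ h₂
    exact ⟨h₀, h₁, h₂⟩

theorem isPrincipalIdealRing_ringOfIntegers (hB : minpoly ℚ B.gen = X ^ 3 - 6) :
    IsPrincipalIdealRing (𝓞 K) := by
  obtain ⟨θ, h⟩ := exists_isCubeRootSixBasis hB
  refine RingOfIntegers.isPrincipalIdealRing_of_isPrincipal_of_pow_le_of_mem_primesOver_of_mem_Icc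
    fun p hp hpp P hP _ => ?_
  have := hP.1
  have hr : Module.finrank ℚ K = 3 := by rw [B.finrank, dim_eq_three hB]
  have hc : InfinitePlace.nrComplexPlaces K ≤ 1 := by
    have := InfinitePlace.card_add_two_mul_card_eq_rank K
    omega
  have hM : (4 / Real.pi) ^ InfinitePlace.nrComplexPlaces K * ((Module.finrank ℚ K).factorial /
      (Module.finrank ℚ K) ^ (Module.finrank ℚ K) * √|discr K|) < (9 : ℕ) := by
    have h1 : 4 / Real.pi < 1.274 := by
      rw [div_lt_iff₀ Real.pi_pos]
      linarith [Real.pi_gt_d4]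
    have h2 : (4 / Real.pi) ^ InfinitePlace.nrComplexPlaces K ≤ 4 / Real.pi := by
      refine (pow_le_pow_right₀ ?_ hc).trans_eq (pow_one _)
      rw [one_le_div Real.pi_pos]
      exact Real.pi_le_four
    have h3 : √972 < (31.2 : ℝ) := by
      rw [Real.sqrt_lt' (by norm_num)]
      norm_num
    rw [hr, discr_eq hB]
    calc _ ≤ 1.274 * (((3).factorial : ℝ) / 3 ^ 3 * √972) := by
          push_cast
          rw [abs_neg, abs_of_pos (by norm_num)]
          gcongr
          exact h2.trans h1.le
      _ < _ := by
          norm_num [Nat.factorial] at h3 ⊢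
          linarith
  have hp9 : p < 9 := (Finset.mem_Icc.mp hp).2.trans_lt ((Nat.floor_lt (by positivity)).mpr hM)
  have hpP : ((p : ℤ) : 𝓞 K) ∈ P := by
    have := hP.2
    exact (Ideal.mem_of_liesOver P (Ideal.span {(p : ℤ)}) p).mp (Ideal.mem_span_singleton_self _)
  refine h.isPrincipal_of_mem (p := p) ?_ hpP
  clear * - hpp hp9
  interval_cases p <;> first | omega | norm_num at hpp

theorem int_pow_three_add_six_mul_ne {a b c : ℤ} (hab : IsCoprime a b) :
    a ^ 3 + 6 * b ^ 3 ≠ 10 * c ^ 3 := by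
  have hirr := irreducible_X_pow_three_sub_six
  have : Fact (Irreducible (X ^ 3 - 6 : ℚ[X])) := ⟨hirr⟩
  let B := AdjoinRoot.powerBasis hirr.ne_zero
  have := B.finite
  have := charZero_of_injective_algebraMap (algebraMap ℚ (AdjoinRoot (X ^ 3 - 6 : ℚ[X]))).injective
  have : NumberField (AdjoinRoot (X ^ 3 - 6 : ℚ[X])) := { }
  have hB : minpoly ℚ B.gen = X ^ 3 - 6 := by
    have hmonic : (X ^ 3 - 6 : ℚ[X]).Monic := by monicity!
    refine (minpoly.eq_of_irreducible_of_monic hirr ?_ hmonic).symm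
    have h0 := AdjoinRoot.eval₂_root (X ^ 3 - 6 : ℚ[X])
    rw [eval₂_sub, eval₂_pow, eval₂_X, eval₂_ofNat] at h0
    rw [AdjoinRoot.powerBasis_gen, map_sub, map_pow, aeval_X, map_ofNat]
    exact h0
  let φ : AdjoinRoot (X ^ 3 - 6 : ℚ[X]) →+* ℝ :=
    AdjoinRoot.lift (algebraMap ℚ ℝ) ((6 : ℝ) ^ (1 / 3 : ℝ)) (by
      rw [eval₂_sub, eval₂_pow, eval₂_X, eval₂_ofNat, ← Real.rpow_natCast,
        ← Real.rpow_mul (by norm_num)]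
      norm_num)
  obtain ⟨θ, h⟩ := exists_isCubeRootSixBasis hB
  have := isPrincipalIdealRing_ringOfIntegers hB
  exact h.pow_three_add_six_mul_ne (φ.comp (algebraMap _ _)) hab

end CubicField

theorem eq_zero_of_pow_three_add_six_mul_eq {a b c : ℤ} (h : a ^ 3 + 6 * b ^ 3 = 10 * c ^ 3) :
    a = 0 ∧ b = 0 ∧ c = 0 := by
  induction hn : a.natAbs + b.natAbs using Nat.strong_induction_on generalizing a b c with
  | _ n ih =>
    by_cases hab : a = 0 ∧ b = 0
    · obtain ⟨rfl, rfl⟩ := hab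
      simpa using h
    have hgcd : Int.gcd a b ≠ 1 := fun hg =>
      int_pow_three_add_six_mul_ne (Int.isCoprime_iff_gcd_eq_one.mpr hg) h
    obtain ⟨p, hp, hpg⟩ := Nat.exists_prime_and_dvd hgcd
    obtain ⟨a, rfl⟩ := (Int.natCast_dvd_natCast.mpr hpg).trans (Int.gcd_dvd_left a b)
    obtain ⟨b, rfl⟩ := (Int.natCast_dvd_natCast.mpr hpg).trans (Int.gcd_dvd_right (p * a) b)
    have hpc : (p : ℤ) ∣ c := by
      by_contra hpc
      have hdvd : (p : ℤ) ^ 3 ∣ 10 * c ^ 3 := ⟨a ^ 3 + 6 * b ^ 3, by rw [← h]; ring⟩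
      have h10 := (((Nat.prime_iff_prime_int.mp hp).coprime_iff_not_dvd.mpr hpc).pow
        (m := 3) (n := 3)).dvd_of_dvd_mul_right hdvd
      norm_cast at h10
      have hp3 : p < 3 := by
        by_contra! hp3
        have := Nat.pow_le_pow_left hp3 3
        have := Nat.le_of_dvd (by norm_num) h10
        omega
      have hp2 := hp.two_le
      interval_cases p
      omega
    obtain ⟨c, rfl⟩ := hpc
    have hp0 : (p : ℤ) ^ 3 ≠ 0 := by simp [hp.ne_zero]
    have hlt : a.natAbs + b.natAbs < n := by
      rw [← hn, Int.natAbs_mul, Int.natAbs_mul, Int.natAbs_natCast, ← mul_add]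
      have : a.natAbs + b.natAbs ≠ 0 := fun h0 => hab (by simp_all)
      have := hp.two_le
      nlinarith [Nat.pos_of_ne_zero ‹a.natAbs + b.natAbs ≠ 0›]
    have key : a ^ 3 + 6 * b ^ 3 = 10 * c ^ 3 :=
      mul_left_cancel₀ hp0 (by linear_combination h)
    obtain ⟨ha, hb, hc⟩ := ih _ hlt key rfl
    simp [ha, hb, hc]

/-- The Selmer curve `3x³ + 4y³ + 5z³ = 0` has no nontrivial rational points. -/
theorem selmer_no_rational_points (x y z : ℚ)
    (h : 3 * x ^ 3 + 4 * y ^ 3 + 5 * z ^ 3 = 0) :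
    x = 0 ∧ y = 0 ∧ z = 0 := by
  have hx : (x.den : ℚ) ≠ 0 := by simp
  have hy : (y.den : ℚ) ≠ 0 := by simp
  have hz : (z.den : ℚ) ≠ 0 := by simp
  have hint : (2 * (y.num * x.den * z.den)) ^ 3 + 6 * (x.num * y.den * z.den) ^ 3 =
      10 * (-(z.num * x.den * y.den)) ^ 3 := by
    rw [← Rat.num_div_den x, ← Rat.num_div_den y, ← Rat.num_div_den z] at h
    rw [← Int.cast_inj (α := ℚ)]
    push_cast
    field_simp at h
    linear_combination 2 * h
  simpa [and_left_comm] using eq_zero_of_pow_three_add_six_mul_eq hint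
end

section
/- The Selmer curve has points everywhere locally: for every prime number p there exist elements x, y, z of the field ℚ_p of p-adic numbers, not all zero, such that 3x³ + 4y³ + 5z³ = 0. -/
open Polynomial in
/-- Hensel's lemma for the binomial cubic `a X³ + b`. -/
theorem exists_padic_root_of_norm_lt {p : ℕ} [Fact p.Prime] {a b : ℤ} (n : ℤ_[p])
    (h : ‖(a : ℤ_[p]) * n ^ 3 + b‖ < ‖3 * (a : ℤ_[p]) * n ^ 2‖ ^ 2) :
    ∃ t : ℚ_[p], (a : ℚ_[p]) * t ^ 3 + b = 0 := by
  have hF : ∀ x : ℤ_[p], (C a * X ^ 3 + C b : ℤ[X]).aeval x = a * x ^ 3 + b := fun x => by simp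
  have hF' : (derivative (C a * X ^ 3 + C b : ℤ[X])).aeval n = 3 * a * n ^ 2 := by
    simp [map_ofNat]
    ring
  obtain ⟨z, hz, -⟩ := hensels_lemma (F := (C a * X ^ 3 + C b : ℤ[X])) (a := n)
    (by rwa [hF, hF'])
  exact ⟨z, by exact_mod_cast congrArg ((↑) : ℤ_[p] → ℚ_[p]) ((hF z).symm.trans hz)⟩

/-- A root of `a X³ + b` modulo `p` lifts to `ℚ_p` when `p` divides neither `3` nor `b`. -/
theorem exists_padic_root_of_zmod_root {p : ℕ} [Fact p.Prime] {a b : ℤ} (t : ZMod p)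
    (h3 : (3 : ZMod p) ≠ 0) (hb : (b : ZMod p) ≠ 0) (h : (a : ZMod p) * t ^ 3 + b = 0) :
    ∃ t : ℚ_[p], (a : ℚ_[p]) * t ^ 3 + b = 0 := by
  obtain ⟨n, rfl⟩ := ZMod.intCast_surjective t
  have ht : (3 * a * n ^ 2 : ZMod p) ≠ 0 := by
    intro h0
    rcases mul_eq_zero.1 h0 with h0 | h0
    · rcases mul_eq_zero.1 h0 with h0 | h0
      · exact h3 h0
      · simp_all
    · simp_all
  refine exists_padic_root_of_norm_lt (n : ℤ_[p]) ?_
  have h1 : ‖((a * n ^ 3 + b : ℤ) : ℤ_[p])‖ < 1 := by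
    rw [PadicInt.norm_int_lt_one_iff_dvd, ← ZMod.intCast_zmod_eq_zero_iff_dvd]
    exact_mod_cast h
  have h2 : ‖((3 * a * n ^ 2 : ℤ) : ℤ_[p])‖ = 1 := by
    refine le_antisymm (PadicInt.norm_le_one _) (not_lt.1 fun hlt => ht ?_)
    rw [PadicInt.norm_int_lt_one_iff_dvd, ← ZMod.intCast_zmod_eq_zero_iff_dvd] at hlt
    exact_mod_cast hlt
  push_cast at h1 h2
  rwa [h2, one_pow]

/-- Cubes have index at most `3` in a finite cyclic group, so two of any four elements agree
modulo cubes. -/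
theorem IsCyclic.exists_ne_eq_mul_cube {G : Type*} [CommGroup G] [IsCyclic G] [Finite G]
    (f : Fin 4 → G) : ∃ i j, i < j ∧ ∃ s, f j = f i * s ^ 3 := by
  let H : Subgroup G := (powMonoidHom 3).range
  have hcard : Nat.card (G ⧸ H) < Nat.card (Fin 4) := by
    have h : Nat.card (G ⧸ H) = _ := IsCyclic.index_powMonoidHom_range (G := G) 3
    rw [h, Nat.card_eq_fintype_card (α := Fin 4), Fintype.card_fin]
    exact Nat.lt_succ_of_le (Nat.gcd_le_right _ (by norm_num))
  have key : ∃ i j, i ≠ j ∧ (f i : G ⧸ H) = f j := by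
    by_contra! hinj
    have : Function.Injective fun i => (f i : G ⧸ H) := fun i j hij => by
      by_contra hne
      exact hinj i j hne hij
    exact hcard.not_ge (Nat.card_le_card_of_injective _ this)
  have lift : ∀ {i j}, (f i : G ⧸ H) = f j → ∃ s, f j = f i * s ^ 3 := fun {i j} hij => by
    obtain ⟨s, hs⟩ := QuotientGroup.eq.1 hij
    exact ⟨s, by rw [← powMonoidHom_apply, hs, mul_inv_cancel_left]⟩
  obtain ⟨i, j, hne, hij⟩ := key
  rcases hne.lt_or_gt with hlt | hlt
  · exact ⟨i, j, hlt, lift hij⟩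
  · exact ⟨j, i, hlt, lift hij.symm⟩

/-- In a field of characteristic prime to `30`, `3`, `4` and `5` cannot be pairwise inequivalent and
all different from `1` modulo cubes. -/
theorem exists_cube_relation {K : Type*} [Field K] [Finite K]
    (h2 : (2 : K) ≠ 0) (h3 : (3 : K) ≠ 0) (h5 : (5 : K) ≠ 0) :
    ∃ s : K, s ≠ 0 ∧ (3 = s ^ 3 ∨ 4 = s ^ 3 ∨ 5 = s ^ 3 ∨
      4 = 3 * s ^ 3 ∨ 5 = 3 * s ^ 3 ∨ 5 = 4 * s ^ 3) := by
  have h4 : (4 : K) ≠ 0 := by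
    rw [show (4 : K) = 2 * 2 by norm_num]
    exact mul_ne_zero h2 h2
  obtain ⟨i, j, hij, s, hs⟩ := IsCyclic.exists_ne_eq_mul_cube
    ![1, Units.mk0 (3 : K) h3, Units.mk0 4 h4, Units.mk0 5 h5]
  refine ⟨s, s.ne_zero, ?_⟩
  replace hs := congrArg Units.val hs
  fin_cases i <;> fin_cases j <;> simp_all

/-- The Selmer curve `3x³ + 4y³ + 5z³ = 0` has points over `ℚ_p` for every prime `p`. -/
theorem selmer_local_points (p : ℕ) [Fact p.Prime] :
    ∃ x y z : ℚ_[p], ¬(x = 0 ∧ y = 0 ∧ z = 0) ∧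
      3 * x ^ 3 + 4 * y ^ 3 + 5 * z ^ 3 = 0 := by
  have of_three : (∃ t : ℚ_[p], ((3 : ℤ) : ℚ_[p]) * t ^ 3 + (9 : ℤ) = 0) →
      ∃ x y z : ℚ_[p], ¬(x = 0 ∧ y = 0 ∧ z = 0) ∧ 3 * x ^ 3 + 4 * y ^ 3 + 5 * z ^ 3 = 0 :=
    fun ⟨t, ht⟩ => ⟨t, 1, 1, by simp, by push_cast at ht; linear_combination ht⟩
  have of_five : (∃ t : ℚ_[p], ((5 : ℤ) : ℚ_[p]) * t ^ 3 + (1 : ℤ) = 0) →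
      ∃ x y z : ℚ_[p], ¬(x = 0 ∧ y = 0 ∧ z = 0) ∧ 3 * x ^ 3 + 4 * y ^ 3 + 5 * z ^ 3 = 0 :=
    fun ⟨t, ht⟩ => ⟨-1, 1, t, by simp, by push_cast at ht; linear_combination ht⟩
  have ne_zero : ∀ q : ℕ, q.Prime → p ≠ q → (q : ZMod p) ≠ 0 := fun q hq hpq h =>
    hpq ((Nat.prime_dvd_prime_iff_eq Fact.out hq).1 ((ZMod.natCast_eq_zero_iff q p).1 h))
  by_cases hp3 : p = 3
  · subst hp3
    obtain ⟨t, ht⟩ := exists_padic_root_of_norm_lt (p := 3) (a := 4) (b := 5) (-2) (by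
      have h3 : ‖(3 : ℤ_[3])‖ = 3⁻¹ := by simpa using PadicInt.norm_p (p := 3)
      have h16 : ‖(16 : ℤ_[3])‖ = 1 := by
        refine le_antisymm (PadicInt.norm_le_one _) (not_lt.1 fun hlt => ?_)
        have := (PadicInt.norm_int_lt_one_iff_dvd (p := 3) 16).1 (by exact_mod_cast hlt)
        norm_num at this
      have e1 : ((4 : ℤ) : ℤ_[3]) * (-2) ^ 3 + (5 : ℤ) = -3 ^ 3 := by norm_num
      have e2 : 3 * ((4 : ℤ) : ℤ_[3]) * (-2) ^ 2 = 3 * 16 := by norm_num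
      rw [e1, e2, norm_neg, norm_pow, norm_mul, h3, h16]
      norm_num)
    exact ⟨0, t, 1, by simp, by push_cast at ht; linear_combination ht⟩
  have h3 : (3 : ZMod p) ≠ 0 := ne_zero 3 Nat.prime_three hp3
  have h9 : ((9 : ℤ) : ZMod p) ≠ 0 := by
    rw [show (9 : ℤ) = 3 ^ 2 by norm_num]
    exact_mod_cast pow_ne_zero 2 h3
  by_cases hp2 : p = 2
  · subst hp2
    exact of_five (exists_padic_root_of_zmod_root 1 h3 (by simp)
      (by exact_mod_cast (ZMod.intCast_zmod_eq_zero_iff_dvd 6 2).2 (by norm_num)))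
  by_cases hp5 : p = 5
  · subst hp5
    exact of_three (exists_padic_root_of_zmod_root 3 h3 h9
      (by exact_mod_cast (ZMod.intCast_zmod_eq_zero_iff_dvd 90 5).2 (by norm_num)))
  have h2 : (2 : ZMod p) ≠ 0 := ne_zero 2 Nat.prime_two hp2
  have h5 : (5 : ZMod p) ≠ 0 := ne_zero 5 Nat.prime_five hp5
  have h4 : (4 : ZMod p) ≠ 0 := by
    rw [show (4 : ZMod p) = 2 ^ 2 by norm_num]
    exact pow_ne_zero 2 h2
  obtain ⟨s, hs0, hs | hs | hs | hs | hs | hs⟩ := exists_cube_relation h2 h3 h5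
  · refine of_three (exists_padic_root_of_zmod_root (-s) h3 h9 ?_)
    push_cast
    linear_combination 3 * hs
  · obtain ⟨t, ht⟩ := exists_padic_root_of_zmod_root (p := p) (a := 4) (b := 8) (-2 / s) h3
      (by
        rw [show (8 : ℤ) = 2 ^ 3 by norm_num]
        exact_mod_cast pow_ne_zero 3 h2)
      (by
        push_cast
        field_simp
        linear_combination -8 * hs)
    exact ⟨1, t, 1, by simp, by push_cast at ht; linear_combination ht⟩
  · refine of_five (exists_padic_root_of_zmod_root (-1 / s) h3 (by simp) ?_)
    push_cast
    field_simp
    linear_combination -hs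
  · obtain ⟨t, ht⟩ := exists_padic_root_of_zmod_root (p := p) (a := 3) (b := -4) s h3
      (by simpa using h4) (by push_cast; linear_combination -hs)
    exact ⟨t, -1, 0, by simp, by push_cast at ht; linear_combination ht⟩
  · obtain ⟨t, ht⟩ := exists_padic_root_of_zmod_root (p := p) (a := 3) (b := -5) s h3
      (by simpa using h5) (by push_cast; linear_combination -hs)
    exact ⟨t, 0, -1, by simp, by push_cast at ht; linear_combination ht⟩
  · obtain ⟨t, ht⟩ := exists_padic_root_of_zmod_root (p := p) (a := 4) (b := -5) s h3
      (by simpa using h5) (by push_cast; linear_combination -hs)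
    exact ⟨0, t, -1, by simp, by push_cast at ht; linear_combination ht⟩
end
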